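/- Every translating graph in ℝ³ is L-stable: if Σ ⊂ ℝ³ is a translating soliton (H + ⟨e₃, ν⟩ = 0) which is the graph of a smooth function over a domain in ℝ², then for every smooth compactly supported function φ on Σ one has ∫_Σ φ Lφ e^{x₃} dμ ≤ 0, where Lφ = Δφ + |A|²φ + ⟨e₃, ∇φ⟩. -/

import Mathlib

noncomputable section

open MeasureTheory Real Set Filter
open scoped RealInnerProductSpace Topology NNReal ENNReal

/-- The Euclidean plane, used as parameter domain for surfaces. -/
abbrev E2 : Type := EuclideanSpace ℝ (Fin 2)
/-- Euclidean three-space, the ambient space. -/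
abbrev E3 : Type := EuclideanSpace ℝ (Fin 3)

/-- The vertical direction `e₃ = (0,0,1)`. -/
def e3 : E3 := EuclideanSpace.single 2 1

/-- Partial derivative of a map on the plane in the `i`-th coordinate direction. -/
def pd {F : Type*} [NormedAddCommGroup F] [NormedSpace ℝ F]
    (i : Fin 2) (X : E2 → F) (y : E2) : F :=
  fderiv ℝ X y (EuclideanSpace.single i 1)

/-- Cross product of vectors in `ℝ³`. -/
def cross (a b : E3) : E3 :=
  (EuclideanSpace.equiv (Fin 3) ℝ).symm
    ![a 1 * b 2 - a 2 * b 1, a 2 * b 0 - a 0 * b 2, a 0 * b 1 - a 1 * b 0]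

/-- Unit normal of a parametrized surface `X : E2 → E3`. -/
def unitNormal (X : E2 → E3) (y : E2) : E3 :=
  ‖cross (pd 0 X y) (pd 1 X y)‖⁻¹ • cross (pd 0 X y) (pd 1 X y)

/-- First fundamental form (induced metric) of a parametrized surface. -/
def fff (X : E2 → E3) (y : E2) : Matrix (Fin 2) (Fin 2) ℝ :=
  Matrix.of fun i j => ⟪pd i X y, pd j X y⟫

/-- Inverse of the induced metric. -/
def fffInv (X : E2 → E3) (y : E2) : Matrix (Fin 2) (Fin 2) ℝ := (fff X y)⁻¹

/-- Area element `√(det g)` of a parametrized surface. -/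
def areaEl (X : E2 → E3) (y : E2) : ℝ := Real.sqrt (fff X y).det

/-- Second fundamental form, with the sign convention that the first variation of
area in the normal direction `η ν` is `∫ η H`. -/
def sff (X : E2 → E3) (y : E2) : Matrix (Fin 2) (Fin 2) ℝ :=
  Matrix.of fun i j => -⟪pd i (pd j X) y, unitNormal X y⟫

/-- Mean curvature `H = trace(g⁻¹ a)`. -/
def meanCurv (X : E2 → E3) (y : E2) : ℝ := Matrix.trace (fffInv X y * sff X y)

/-- Squared norm `|A|²` of the second fundamental form. -/
def sffNormSq (X : E2 → E3) (y : E2) : ℝ :=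
  Matrix.trace (fffInv X y * sff X y * (fffInv X y * sff X y))

/-- Surface (tangential) gradient of a function, as a vector in `ℝ³`. -/
def surfGrad (X : E2 → E3) (f : E2 → ℝ) (y : E2) : E3 :=
  ∑ i, ∑ j, (fffInv X y i j * pd j f y) • pd i X y

/-- Surface Laplace–Beltrami operator. -/
def surfLap (X : E2 → E3) (f : E2 → ℝ) (y : E2) : ℝ :=
  (areaEl X y)⁻¹ *
    ∑ i, pd i (fun z => areaEl X z * ∑ j, fffInv X z i j * pd j f z) y

/-- The stability operator `L η = Δη + |A|² η + ⟨e₃, ∇η⟩`. -/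
def Lop (X : E2 → E3) (f : E2 → ℝ) (y : E2) : ℝ :=
  surfLap X f y + sffNormSq X y * f y + ⟪e3, surfGrad X f y⟫

/-- Graph parametrization `y ↦ (y₁, y₂, u(y))`. -/
def graphMap (u : E2 → ℝ) (y : E2) : E3 :=
  (EuclideanSpace.equiv (Fin 3) ℝ).symm ![y 0, y 1, u y]

/-- Length of the curve `t ↦ X (γ t)`, `t ∈ [0,1]`, on the surface parametrized by `X`. -/
def curveLen (X : E2 → E3) (γ : ℝ → E2) : ℝ :=
  ∫ t in (0:ℝ)..1, ‖derivWithin (fun s => X (γ s)) (Set.Icc 0 1) t‖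

/-- Intrinsic (induced) distance between points of a parametrized surface. -/
def intrinsicDist (X : E2 → E3) (U : Set E2) (a b : E2) : ℝ :=
  sInf (curveLen X ''
    {γ : ℝ → E2 | γ 0 = a ∧ γ 1 = b ∧ (∀ t ∈ Set.Icc (0:ℝ) 1, γ t ∈ U) ∧
      DifferentiableOn ℝ γ (Set.Icc 0 1)})

/-- Completeness of a parametrized surface in its intrinsic metric, phrased via
convergence of intrinsically Cauchy sequences. -/
def IntrinsicComplete (X : E2 → E3) (U : Set E2) : Prop :=
  ∀ z : ℕ → E2, (∀ n, z n ∈ U) →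
    (∀ ε > 0, ∃ N, ∀ m ≥ N, ∀ n ≥ N, intrinsicDist X U (z m) (z n) < ε) →
    ∃ l ∈ U, Filter.Tendsto (fun n => intrinsicDist X U (z n) l) Filter.atTop (𝓝 0)



/-- `f` is differentiable with `i`-th partial derivative `c`. -/
def HasPd (i : Fin 2) (f : E2 → ℝ) (c : ℝ) (y : E2) : Prop :=
  DifferentiableAt ℝ f y ∧ pd i f y = c

lemma HasPd.mul {i : Fin 2} {f g : E2 → ℝ} {a b : ℝ} {y : E2} (hf : HasPd i f a y)
    (hg : HasPd i g b y) : HasPd i (fun z => f z * g z) (a * g y + f y * b) y := by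
  obtain ⟨hf, rfl⟩ := hf
  obtain ⟨hg, rfl⟩ := hg
  refine ⟨hf.mul hg, ?_⟩
  simp only [pd]
  rw [fderiv_fun_mul hf hg]
  simp
  ring

lemma HasPd.add {i : Fin 2} {f g : E2 → ℝ} {a b : ℝ} {y : E2} (hf : HasPd i f a y)
    (hg : HasPd i g b y) : HasPd i (fun z => f z + g z) (a + b) y := by
  obtain ⟨hf, rfl⟩ := hf
  obtain ⟨hg, rfl⟩ := hg
  refine ⟨hf.add hg, ?_⟩
  simp only [pd]
  rw [fderiv_fun_add hf hg]
  simp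

lemma HasPd.sub {i : Fin 2} {f g : E2 → ℝ} {a b : ℝ} {y : E2} (hf : HasPd i f a y)
    (hg : HasPd i g b y) : HasPd i (fun z => f z - g z) (a - b) y := by
  obtain ⟨hf, rfl⟩ := hf
  obtain ⟨hg, rfl⟩ := hg
  refine ⟨hf.sub hg, ?_⟩
  simp only [pd]
  rw [fderiv_fun_sub hf hg]
  simp

lemma HasPd.const (i : Fin 2) (c : ℝ) (y : E2) : HasPd i (fun _ => c) 0 y := by
  refine ⟨differentiableAt_const _, ?_⟩
  simp [pd]

lemma HasPd.comp {i : Fin 2} {f : E2 → ℝ} {a : ℝ} {y : E2} {h : ℝ → ℝ} {h' : ℝ}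
    (hh : HasDerivAt h h' (f y)) (hf : HasPd i f a y) :
    HasPd i (fun z => h (f z)) (h' * a) y := by
  obtain ⟨hf, rfl⟩ := hf
  have := hh.comp_hasFDerivAt y hf.hasFDerivAt
  refine ⟨this.differentiableAt, ?_⟩
  simp only [pd]
  erw [this.fderiv]
  simp

lemma HasPd.sq {i : Fin 2} {f : E2 → ℝ} {a : ℝ} {y : E2} (hf : HasPd i f a y) :
    HasPd i (fun z => f z ^ 2) (2 * f y * a) y := by
  have : HasDerivAt (fun x : ℝ => x ^ 2) (2 * f y) (f y) := by
    simpa using hasDerivAt_pow 2 (f y)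
  exact HasPd.comp this hf

lemma HasPd.congr {i : Fin 2} {f g : E2 → ℝ} {a b : ℝ} {y : E2} (hf : HasPd i f a y)
    (h : g =ᶠ[𝓝 y] f) (hab : a = b) : HasPd i g b y := by
  obtain ⟨hf, rfl⟩ := hf
  subst hab
  exact ⟨hf.congr_of_eventuallyEq h, by simp only [pd]; rw [h.fderiv_eq]⟩

/-- Smooth on `U`. -/
def SmOn (U : Set E2) (f : E2 → ℝ) : Prop := ContDiffOn ℝ (⊤ : ℕ∞) f U

lemma SmOn.at {U : Set E2} (hU : IsOpen U) {f : E2 → ℝ} (hf : SmOn U f) {y : E2} (hy : y ∈ U) :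
    ContDiffAt ℝ (⊤ : ℕ∞) f y := ContDiffOn.contDiffAt hf (hU.mem_nhds hy)

lemma SmOn.pd {U : Set E2} (hU : IsOpen U) {f : E2 → ℝ} (hf : SmOn U f) (i : Fin 2) :
    SmOn U (pd i f) := by
  intro y hy
  have h := (hf.at hU hy)
  have h2 : ContDiffAt ℝ (⊤ : ℕ∞) (fderiv ℝ f) y := h.fderiv_right (by simp)
  exact (h2.clm_apply contDiffAt_const).contDiffWithinAt

lemma SmOn.hasPd {U : Set E2} (hU : IsOpen U) {f : E2 → ℝ} (hf : SmOn U f) (i : Fin 2)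
    {y : E2} (hy : y ∈ U) : HasPd i f (_root_.pd i f y) y :=
  ⟨(hf.at hU hy).differentiableAt (by simp), rfl⟩

lemma SmOn.mul {U : Set E2} {f g : E2 → ℝ} (hf : SmOn U f) (hg : SmOn U g) :
    SmOn U (fun z => f z * g z) := ContDiffOn.mul hf hg
lemma SmOn.add {U : Set E2} {f g : E2 → ℝ} (hf : SmOn U f) (hg : SmOn U g) :
    SmOn U (fun z => f z + g z) := ContDiffOn.add hf hg
lemma SmOn.sub {U : Set E2} {f g : E2 → ℝ} (hf : SmOn U f) (hg : SmOn U g) :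
    SmOn U (fun z => f z - g z) := ContDiffOn.sub hf hg
lemma SmOn.sq {U : Set E2} {f : E2 → ℝ} (hf : SmOn U f) :
    SmOn U (fun z => f z ^ 2) := ContDiffOn.pow hf 2
lemma SmOn.const (U : Set E2) (c : ℝ) : SmOn U (fun _ => c) := contDiffOn_const
lemma SmOn.exp {U : Set E2} {f : E2 → ℝ} (hf : SmOn U f) :
    SmOn U (fun z => Real.exp (f z)) := ContDiffOn.exp hf
lemma SmOn.sqrt {U : Set E2} {f : E2 → ℝ} (hf : SmOn U f) (h : ∀ z, f z ≠ 0) :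
    SmOn U (fun z => Real.sqrt (f z)) := ContDiffOn.sqrt hf (fun z _ => h z)
lemma SmOn.inv {U : Set E2} {f : E2 → ℝ} (hf : SmOn U f) (h : ∀ z, f z ≠ 0) :
    SmOn U (fun z => (f z)⁻¹) := ContDiffOn.inv hf (fun z _ => h z)

lemma pd_comm {U : Set E2} (hU : IsOpen U) {f : E2 → ℝ} (hf : SmOn U f) (i j : Fin 2)
    {y : E2} (hy : y ∈ U) : pd i (pd j f) y = pd j (pd i f) y := by
  have h := hf.at hU hy
  have hs : IsSymmSndFDerivAt ℝ f y := h.isSymmSndFDerivAt (by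
    simp only [minSmoothness_of_isRCLikeNormedField]; exact WithTop.coe_le_coe.2 le_top)
  have h2 : DifferentiableAt ℝ (fderiv ℝ f) y :=
    (h.fderiv_right (m := (⊤ : ℕ∞)) (by simp)).differentiableAt (by simp)
  have key : ∀ v w : E2, fderiv ℝ (fun z => fderiv ℝ f z v) y w = fderiv ℝ (fderiv ℝ f) y w v := by
    intro v w
    rw [fderiv_clm_apply h2 (differentiableAt_const _)]
    simp
  simp only [pd]
  erw [key, key]
  exact hs _ _

lemma integral_pd_zero {U : Set E2} (hU : IsOpen U) {V : E2 → ℝ} (hV : SmOn U V)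
    {K : Set E2} (hK : IsCompact K) (hKU : K ⊆ U) (hs : Function.support V ⊆ K) (i : Fin 2) :
    IntegrableOn (pd i V) U ∧ ∫ y in U, pd i V y = 0 := by
  have hts : tsupport V ⊆ K := closure_minimal hs hK.isClosed
  have hcs : HasCompactSupport V := HasCompactSupport.of_support_subset_isCompact hK hs
  have hC : ContDiff ℝ (⊤ : ℕ∞) V := by
    rw [contDiff_iff_contDiffAt]
    intro y
    by_cases hy : y ∈ tsupport V
    · exact hV.at hU (hKU (hts hy))
    · have : V =ᶠ[𝓝 y] fun _ => 0 := notMem_tsupport_iff_eventuallyEq.mp hy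
      exact contDiffAt_const.congr_of_eventuallyEq this
  have hd : Continuous (fderiv ℝ V) := hC.continuous_fderiv (by simp)
  have hpc : Continuous (pd i V) := hd.clm_apply continuous_const
  have hps : HasCompactSupport (pd i V) := hcs.fderiv_apply (𝕜 := ℝ) _
  have hint : Integrable (pd i V) := hpc.integrable_of_hasCompactSupport hps
  refine ⟨hint.integrableOn, ?_⟩
  have hsub : Function.support (pd i V) ⊆ U := by
    refine subset_trans ?_ (hts.trans hKU)
    intro y hy
    apply support_fderiv_subset ℝ (f := V)
    intro h0
    apply hy
    simp [pd, h0]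
  rw [setIntegral_eq_integral_of_forall_compl_eq_zero
    (fun x hx => by by_contra h; exact hx (hsub h))]
  have := integral_mul_fderiv_eq_neg_fderiv_mul_of_integrable (μ := (volume : Measure E2))
    (f := fun _ : E2 => (1:ℝ)) (g := V) (v := EuclideanSpace.single i 1)
    (by simp) (by simpa [pd] using! hint)
    (by simpa using hC.continuous.integrable_of_hasCompactSupport hcs)
    (fun _ _ => differentiableAt_const _) (fun x _ => hC.differentiable (by simp) x)
  simpa [pd] using this

lemma pd_vec (f0 f1 f2 : E2 → ℝ) (i : Fin 2) (a b c : ℝ) (y : E2) (h0 : HasPd i f0 a y)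
    (h1 : HasPd i f1 b y) (h2 : HasPd i f2 c y) :
    pd i (fun z => (!₂[f0 z, f1 z, f2 z] : E3)) y = !₂[a, b, c] := by
  have hX : DifferentiableAt ℝ (fun z => (!₂[f0 z, f1 z, f2 z] : E3)) y := by
    rw [differentiableAt_euclidean]
    intro k
    fin_cases k
    · exact h0.1
    · exact h1.1
    · exact h2.1
  have key : ∀ k : Fin 3, (pd i (fun z => (!₂[f0 z, f1 z, f2 z] : E3)) y) k
      = pd i (fun z => (!₂[f0 z, f1 z, f2 z] : E3) k) y := by
    intro k
    have := ((EuclideanSpace.proj k : E3 →L[ℝ] ℝ).hasFDerivAt.comp y hX.hasFDerivAt)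
    simp only [pd]
    erw [this.fderiv]
    rfl
  ext k
  rw [key]
  fin_cases k
  · exact h0.2
  · exact h1.2
  · exact h2.2

lemma hasPd_coord (i k : Fin 2) (y : E2) :
    HasPd i (fun z => z k) (if k = i then 1 else 0) y := by
  have := (EuclideanSpace.proj k : E2 →L[ℝ] ℝ).hasFDerivAt (x := y)
  refine ⟨this.differentiableAt, ?_⟩
  simp only [pd]
  erw [this.fderiv]
  simp

lemma pd_graph {U : Set E2} (hU : IsOpen U) {u : E2 → ℝ} (hu : SmOn U u) {y : E2} (hy : y ∈ U)
    (i : Fin 2) : pd i (graphMap u) y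
      = !₂[if 0 = i then 1 else 0, if 1 = i then 1 else 0, pd i u y] :=
  pd_vec _ _ _ i _ _ _ y (hasPd_coord i 0 y) (hasPd_coord i 1 y) (hu.hasPd hU i hy)

lemma pd2_graph {U : Set E2} (hU : IsOpen U) {u : E2 → ℝ} (hu : SmOn U u) {y : E2} (hy : y ∈ U)
    (i j : Fin 2) : pd i (pd j (graphMap u)) y
      = !₂[0, 0, pd i (pd j u) y] := by
  have h : pd j (graphMap u) =ᶠ[𝓝 y] fun z =>
      !₂[if 0 = j then 1 else 0, if 1 = j then 1 else 0, pd j u z] := by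
    filter_upwards [hU.mem_nhds hy] with z hz using pd_graph hU hu hz j
  have h2 := pd_vec (fun _ => if 0 = j then 1 else 0) (fun _ => if 1 = j then 1 else 0) (pd j u)
    i 0 0 _ y (HasPd.const _ _ _) (HasPd.const _ _ _) ((hu.pd hU j).hasPd hU i hy)
  rw [← h2]
  simp only [pd] at h ⊢
  rw [h.fderiv_eq]

/-- The quantity `1 + |∇u|²`. -/
def DD (u : E2 → ℝ) (z : E2) : ℝ := 1 + pd 0 u z ^ 2 + pd 1 u z ^ 2

lemma DD_pos (u : E2 → ℝ) (z : E2) : 0 < DD u z := by unfold DD; positivity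

lemma inner_e3 (v : E3) : ⟪e3, v⟫ = v 2 := by
  rw [e3, EuclideanSpace.inner_single_left]; simp

section geom
variable {U : Set E2} (hU : IsOpen U) {u : E2 → ℝ} (hu : SmOn U u) {y : E2} (hy : y ∈ U)
include hU hu hy

lemma fff_graph : fff (graphMap u) y =
    !![1 + pd 0 u y ^ 2, pd 0 u y * pd 1 u y; pd 0 u y * pd 1 u y, 1 + pd 1 u y ^ 2] := by
  ext i j
  simp only [fff, Matrix.of_apply, pd_graph hU hu hy]
  fin_cases i <;> fin_cases j <;> simp [-inner_self_eq_norm_sq_to_K, PiLp.inner_apply, Fin.sum_univ_three] <;> ring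

lemma det_graph : (fff (graphMap u) y).det = DD u y := by
  rw [fff_graph hU hu hy, Matrix.det_fin_two_of, DD]; ring

lemma areaEl_graph : areaEl (graphMap u) y = Real.sqrt (DD u y) := by
  rw [areaEl, det_graph hU hu hy]

lemma fffInv_graph : fffInv (graphMap u) y = (DD u y)⁻¹ •
    !![1 + pd 1 u y ^ 2, - (pd 0 u y * pd 1 u y); - (pd 0 u y * pd 1 u y), 1 + pd 0 u y ^ 2] := by
  rw [fffInv, Matrix.inv_def, det_graph hU hu hy, fff_graph hU hu hy, Matrix.adjugate_fin_two_of,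
    Ring.inverse_eq_inv']

lemma unitNormal_graph : unitNormal (graphMap u) y =
    (Real.sqrt (DD u y))⁻¹ • !₂[- pd 0 u y, - pd 1 u y, 1] := by
  have hc : cross (pd 0 (graphMap u) y) (pd 1 (graphMap u) y) = !₂[- pd 0 u y, - pd 1 u y, 1] := by
    rw [pd_graph hU hu hy, pd_graph hU hu hy]
    ext k
    fin_cases k <;> simp [cross]
  rw [unitNormal, hc]
  congr 2
  rw [EuclideanSpace.norm_eq]
  simp [Fin.sum_univ_three, DD]
  ring_nf

lemma sff_graph : sff (graphMap u) y = (-(Real.sqrt (DD u y))⁻¹) •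
    !![pd 0 (pd 0 u) y, pd 1 (pd 0 u) y; pd 1 (pd 0 u) y, pd 1 (pd 1 u) y] := by
  have hsym := pd_comm hU hu 0 1 hy
  ext i j
  simp only [sff, Matrix.of_apply, pd2_graph hU hu hy, unitNormal_graph hU hu hy]
  fin_cases i <;> fin_cases j <;> simp [PiLp.inner_apply, Fin.sum_univ_three, hsym]

lemma sffNormSq_graph : sffNormSq (graphMap u) y =
    (DD u y)⁻¹ ^ 3 * (((1+pd 1 u y^2)*pd 0 (pd 0 u) y-pd 0 u y*pd 1 u y*pd 1 (pd 0 u) y)^2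
      + 2 * ((1+pd 1 u y^2)*pd 1 (pd 0 u) y-pd 0 u y*pd 1 u y*pd 1 (pd 1 u) y)
        *((-pd 0 u y*pd 1 u y)*pd 0 (pd 0 u) y+(1+pd 0 u y^2)*pd 1 (pd 0 u) y)
      + (-pd 0 u y*pd 1 u y*pd 1 (pd 0 u) y+(1+pd 0 u y^2)*pd 1 (pd 1 u) y)^2) := by
  have hW : (Real.sqrt (DD u y))⁻¹ ^ 2 = (DD u y)⁻¹ := by
    rw [inv_pow, Real.sq_sqrt (DD_pos u y).le]
  rw [sffNormSq, fffInv_graph hU hu hy, sff_graph hU hu hy]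
  rw [pow_succ _ 2, ← hW]
  generalize (Real.sqrt (DD u y))⁻¹ = w at *
  simp [Matrix.trace_fin_two]
  ring

lemma meanCurv_graph (h : meanCurv (graphMap u) y + ⟪e3, unitNormal (graphMap u) y⟫ = 0) :
    (1+pd 1 u y^2)*pd 0 (pd 0 u) y - 2*pd 0 u y*pd 1 u y*pd 1 (pd 0 u) y
      + (1+pd 0 u y^2)*pd 1 (pd 1 u) y = DD u y := by
  have hD := DD_pos u y
  have hw : 0 < (Real.sqrt (DD u y))⁻¹ := by positivity
  rw [meanCurv, fffInv_graph hU hu hy, sff_graph hU hu hy, unitNormal_graph hU hu hy] at h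
  rw [inner_e3] at h
  generalize (Real.sqrt (DD u y))⁻¹ = w at *
  simp [Matrix.trace_fin_two] at h
  generalize DD u y = D at *
  field_simp at h
  have h2 : w * ((1+pd 1 u y^2)*pd 0 (pd 0 u) y - 2*pd 0 u y*pd 1 u y*pd 1 (pd 0 u) y
      + (1+pd 0 u y^2)*pd 1 (pd 1 u) y) = w * D := by linear_combination -h
  exact mul_left_cancel₀ hw.ne' h2

lemma grad_graph (f : E2 → ℝ) : ⟪e3, surfGrad (graphMap u) f y⟫ = (DD u y)⁻¹ *
    (pd 0 u y * ((1+pd 1 u y^2) * pd 0 f y - pd 0 u y * pd 1 u y * pd 1 f y)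
     + pd 1 u y * (-pd 0 u y * pd 1 u y * pd 0 f y + (1+pd 0 u y^2) * pd 1 f y)) := by
  simp only [surfGrad, fffInv_graph hU hu hy, pd_graph hU hu hy]
  rw [inner_e3]
  simp [Fin.sum_univ_two]
  ring

end geom

lemma jacobi_alg (p q r s t r0 r1 s1 t1 : ℝ)
    (P : (1+q^2)*r - 2*p*q*s + (1+p^2)*t = 1+p^2+q^2)
    (P0 : (2*q*s)*r + (1+q^2)*r0 - 2*(r*q+p*s)*s - 2*p*q*r1 + 2*p*r*t+(1+p^2)*s1 = 2*(p*r+q*s))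
    (P1 : (2*q*t)*r + (1+q^2)*r1 - 2*(s*q+p*t)*s - 2*p*q*s1 + 2*p*s*t+(1+p^2)*t1 = 2*(p*s+q*t))
    (b0 b1 N0 N1 : ℝ) (hb0 : b0 = p*r+q*s) (hb1 : b1=p*s+q*t)
    (hN0 : N0 = (1+q^2)*b0 - p*q*b1) (hN1 : N1 = (1+p^2)*b1 - p*q*b0)
    (c0 c1 : ℝ) (hc0 : c0 = r*r + p*r0+s*s+q*r1) (hc1 : c1 = s*s+p*s1 + t*t+q*t1)
    (c : ℝ) (hc : c = r*s + p*r1+s*t+q*s1) :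
    (1+p^2+q^2)*(p*N0+q*N1 + ((2*q*s)*b0 + (1+q^2)*c0 - (r*q+p*s)*b1 - p*q*c)
      + (-(s*q+p*t)*b0 - p*q*c+2*p*s*b1 + (1+p^2)*c1)) - 4*(b0*N0+b1*N1)
    = ((1+q^2)*r-p*q*s)^2 + 2 * ((1+q^2)*s-p*q*t)*((-p*q)*r+(1+p^2)*s)
      + (-p*q*s+(1+p^2)*t)^2 := by
  subst hN0 hN1 hb0 hb1 hc0 hc1 hc
  linear_combination (1+p^2+q^2)*(p*P0+q*P1) - 3*(p*(p*r+q*s)+q*(p*s+q*t))*P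

/-- `1/W`. -/
def RR (u : E2 → ℝ) (z : E2) : ℝ := (Real.sqrt (DD u z))⁻¹

lemma RR_sq (u : E2 → ℝ) (z : E2) : RR u z ^ 2 * DD u z = 1 := by
  have h := DD_pos u z
  rw [RR, inv_pow, Real.sq_sqrt h.le, inv_mul_cancel₀ h.ne']

lemma RR_pos (u : E2 → ℝ) (z : E2) : 0 < RR u z := by
  have h := DD_pos u z
  rw [RR]; positivity

lemma DD_inv (u : E2 → ℝ) (z : E2) : (DD u z)⁻¹ = RR u z ^ 2 := by
  have h := RR_sq u z
  exact (eq_inv_of_mul_eq_one_left h).symm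

lemma sqrt_DD (u : E2 → ℝ) (z : E2) : Real.sqrt (DD u z) = DD u z * RR u z := by
  have h := DD_pos u z
  rw [RR, ← div_eq_mul_inv, Real.div_sqrt]

/-- `∂ᵢ W² / 2`. -/
def bb (u : E2 → ℝ) (i : Fin 2) (z : E2) : ℝ :=
  pd 0 u z * pd i (pd 0 u) z + pd 1 u z * pd i (pd 1 u) z

/-- The matrix `W² g⁻¹` applied to a vector, first component. -/
def M0 (u : E2 → ℝ) (f g : E2 → ℝ) (z : E2) : ℝ :=
  (1 + pd 1 u z ^ 2) * f z - (pd 0 u z * pd 1 u z) * g z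

/-- The matrix `W² g⁻¹` applied to a vector, second component. -/
def M1 (u : E2 → ℝ) (f g : E2 → ℝ) (z : E2) : ℝ :=
  (1 + pd 0 u z ^ 2) * g z - (pd 0 u z * pd 1 u z) * f z

section calc1
variable {U : Set E2} (hU : IsOpen U) {u : E2 → ℝ} (hu : SmOn U u)
include hU hu

lemma DD_sm : SmOn U (DD u) :=
  ((SmOn.const U 1).add (hu.pd hU 0).sq).add (hu.pd hU 1).sq

lemma RR_sm : SmOn U (RR u) :=
  ((DD_sm hU hu).sqrt fun z => (DD_pos u z).ne').inv
    fun z => (Real.sqrt_pos.2 (DD_pos u z)).ne'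

lemma bb_sm (i : Fin 2) : SmOn U (bb u i) :=
  ((hu.pd hU 0).mul ((hu.pd hU 0).pd hU i)).add ((hu.pd hU 1).mul ((hu.pd hU 1).pd hU i))

lemma M0_sm {f g : E2 → ℝ} (hf : SmOn U f) (hg : SmOn U g) : SmOn U (M0 u f g) :=
  (((SmOn.const U 1).add (hu.pd hU 1).sq).mul hf).sub (((hu.pd hU 0).mul (hu.pd hU 1)).mul hg)

lemma M1_sm {f g : E2 → ℝ} (hf : SmOn U f) (hg : SmOn U g) : SmOn U (M1 u f g) :=
  (((SmOn.const U 1).add (hu.pd hU 0).sq).mul hg).sub (((hu.pd hU 0).mul (hu.pd hU 1)).mul hf)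

variable {y : E2} (hy : y ∈ U)
include hy

lemma RR_hasPd (i : Fin 2) : HasPd i (RR u) (- bb u i y * RR u y ^ 3) y := by
  have h1 := ((RR_sm hU hu).hasPd hU i hy)
  have hD : HasPd i (DD u) _ y := ((HasPd.const i 1 y).add ((hu.pd hU 0).hasPd hU i hy).sq).add
    ((hu.pd hU 1).hasPd hU i hy).sq
  have h2 := h1.sq.mul hD
  have h3 : HasPd i (fun z => RR u z ^ 2 * DD u z) 0 y :=
    (HasPd.const i 1 y).congr (Eventually.of_forall fun z => RR_sq u z) rfl
  have h4 := h2.2.symm.trans h3.2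
  refine ⟨h1.1, ?_⟩
  have hR := RR_sq u y
  have hp := RR_pos u y
  unfold bb
  have h5 : 2 * RR u y * DD u y ≠ 0 := by have := DD_pos u y; positivity
  apply mul_left_cancel₀ h5
  linear_combination h4 + 2 * (pd 0 u y * pd i (pd 0 u) y + pd 1 u y * pd i (pd 1 u) y) *
    RR u y ^ 2 * hR

lemma divB (htrans : ∀ y ∈ U, meanCurv (graphMap u) y + ⟪e3, unitNormal (graphMap u) y⟫ = 0) :
    pd 0 (fun z => Real.exp (u z) * (M0 u (bb u 0) (bb u 1) z * (RR u z * RR u z ^ 2))) y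
    + pd 1 (fun z => Real.exp (u z) * (M1 u (bb u 0) (bb u 1) z * (RR u z * RR u z ^ 2))) y
    = Real.exp (u y) * (DD u y * RR u y * sffNormSq (graphMap u) y
      + RR u y ^ 5 * (bb u 0 y * M0 u (bb u 0) (bb u 1) y + bb u 1 y * M1 u (bb u 0) (bb u 1) y))
    := by
  have hpde : ∀ z ∈ U, (1+pd 1 u z^2)*pd 0 (pd 0 u) z - 2*(pd 0 u z*pd 1 u z)*pd 1 (pd 0 u) z
      + (1+pd 0 u z^2)*pd 1 (pd 1 u) z - (1+pd 0 u z^2 + pd 1 u z^2) = 0 := by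
    intro z hz
    have := meanCurv_graph hU hu hz (htrans z hz)
    rw [DD] at this
    linear_combination this
  have hs : ∀ z ∈ U, pd 0 (pd 1 u) z = pd 1 (pd 0 u) z := fun z hz => pd_comm hU hu 0 1 hz
  have hp := fun i => (hu.pd hU 0).hasPd hU i hy
  have hq := fun i => (hu.pd hU 1).hasPd hU i hy
  have hr := fun i => ((hu.pd hU 0).pd hU 0).hasPd hU i hy
  have hss := fun i => ((hu.pd hU 0).pd hU 1).hasPd hU i hy
  have ht := fun i => ((hu.pd hU 1).pd hU 1).hasPd hU i hy
  have hs' : ∀ i, HasPd i (pd 0 (pd 1 u)) (pd i (pd 1 (pd 0 u)) y) y := fun i =>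
    (hss i).congr (by filter_upwards [hU.mem_nhds hy] with z hz using hs z hz) rfl
  have e1 : pd 0 (pd 1 (pd 0 u)) y = pd 1 (pd 0 (pd 0 u)) y := pd_comm hU (hu.pd hU 0) 0 1 hy
  have e2 : pd 0 (pd 1 (pd 1 u)) y = pd 1 (pd 1 (pd 0 u)) y := by
    rw [pd_comm hU (hu.pd hU 1) 0 1 hy, (hs' 1).2]
  have hP : ∀ i, _ := fun i =>
    (((((((HasPd.const i 1 y).add (hq i).sq).mul (hr i)).sub
      (((HasPd.const i 2 y).mul ((hp i).mul (hq i))).mul (hss i))).add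
      (((HasPd.const i 1 y).add (hp i).sq).mul (ht i))).sub
      (((HasPd.const i 1 y).add (hp i).sq).add (hq i).sq)).2).symm.trans
     ((HasPd.const i 0 y).congr
      (by filter_upwards [hU.mem_nhds hy] with z hz using hpde z hz) rfl).2
  have P0 := hP 0
  have P1 := hP 1
  have P := hpde y hy
  have hb0 : ∀ i, HasPd i (bb u 0) _ y := fun i =>
    ((hp i).mul (hr i)).add ((hq i).mul (hs' i))
  have hb1 : ∀ i, HasPd i (bb u 1) _ y := fun i =>
    ((hp i).mul (hss i)).add ((hq i).mul (ht i))
  have hN0 : HasPd 0 (M0 u (bb u 0) (bb u 1)) _ y :=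
    (((HasPd.const 0 1 y).add (hq 0).sq).mul (hb0 0)).sub (((hp 0).mul (hq 0)).mul (hb1 0))
  have hN1 : HasPd 1 (M1 u (bb u 0) (bb u 1)) _ y :=
    (((HasPd.const 1 1 y).add (hp 1).sq).mul (hb1 1)).sub (((hp 1).mul (hq 1)).mul (hb0 1))
  have hR := fun i => RR_hasPd hU hu hy i
  have hE : ∀ i, HasPd i (fun z => Real.exp (u z)) _ y := fun i =>
    HasPd.comp (Real.hasDerivAt_exp (u y)) (hu.hasPd hU i hy)
  rw [((hE 0).mul (hN0.mul ((hR 0).mul (hR 0).sq))).2,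
    ((hE 1).mul (hN1.mul ((hR 1).mul (hR 1).sq))).2]
  rw [sffNormSq_graph hU hu hy, DD_inv]
  have hRD := RR_sq u y
  simp only [M0, M1, bb, DD] at hRD ⊢
  simp only [hs y hy, e1, e2] at P0 P1 hRD ⊢
  generalize pd 0 (pd 0 (pd 0 u)) y = r0 at *
  generalize pd 1 (pd 0 (pd 0 u)) y = r1 at *
  generalize pd 1 (pd 1 (pd 0 u)) y = s1 at *
  generalize pd 1 (pd 1 (pd 1 u)) y = t1 at *
  generalize pd 0 (pd 0 u) y = r at *
  generalize pd 1 (pd 0 u) y = s at *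
  generalize pd 1 (pd 1 u) y = t at *
  generalize pd 0 u y = p at *
  generalize pd 1 u y = q at *
  generalize RR u y = R at *
  generalize Real.exp (u y) = E at *
  have J := jacobi_alg p q r s t r0 r1 s1 t1 (by linear_combination P) (by linear_combination P0)
    (by linear_combination P1) _ _ _ _ rfl rfl rfl rfl _ _ rfl rfl _ rfl
  linear_combination E * R^5 * J - (E * R^3 * (p*((1+q^2)*(p*r+q*s) - p*q*(p*s+q*t))
    +q*((1+p^2)*(p*s+q*t) - p*q*(p*r+q*s)) + ((2*q*s)*(p*r+q*s) + (1+q^2)*(r*r + p*r0+s*s+q*r1)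
      - (r*q+p*s)*(p*s+q*t) - p*q*(r*s + p*r1+s*t+q*s1))
      + (-(s*q+p*t)*(p*r+q*s) - p*q*(r*s + p*r1+s*t+q*s1)+2*p*s*(p*s+q*t)
        + (1+p^2)*(s*s+p*s1 + t*t+q*t1)))
    + E * R^5 * (((1+q^2)*r-p*q*s)^2 + 2 * ((1+q^2)*s-p*q*t)*((-p*q)*r+(1+p^2)*s)
      + (-p*q*s+(1+p^2)*t)^2)) * hRD

end calc1

/-- every translating graph in `ℝ³` is `L`-stable: if `Σ` is the graph
of a smooth function `u` over a domain `Ω ⊂ ℝ²` and satisfies the translating soliton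
equation `H + ⟨e₃, ν⟩ = 0`, then `∫_Σ φ Lφ e^{x₃} dμ ≤ 0` for every smooth compactly
supported function `φ` on `Σ`. -/
theorem translating_graph_is_L_stable
    (U : Set E2) (hU : IsOpen U) (u : E2 → ℝ)
    (hu : ContDiffOn ℝ (⊤ : ℕ∞) u U)
    (htrans : ∀ y ∈ U, meanCurv (graphMap u) y + ⟪e3, unitNormal (graphMap u) y⟫ = 0)
    (φ : E2 → ℝ) (hφ : ContDiffOn ℝ (⊤ : ℕ∞) φ U)
    (K : Set E2) (hK : IsCompact K) (hKU : K ⊆ U)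
    (hsupp : Function.support φ ⊆ K) :
    ∫ y in U, φ y * Lop (graphMap u) φ y
        * Real.exp (graphMap u y 2) * areaEl (graphMap u) y ≤ 0 := by
  have hu' : SmOn U u := hu
  have hφ' : SmOn U φ := hφ
  have hf0 := hφ'.pd hU 0
  have hf1 := hφ'.pd hU 1
  have hb0 := bb_sm hU hu' 0
  have hb1 := bb_sm hU hu' 1
  have hR := RR_sm hU hu'
  have hE := hu'.exp
  set G0 : E2 → ℝ := fun z => RR u z * M0 u (pd 0 φ) (pd 1 φ) z with hG0
  set G1 : E2 → ℝ := fun z => RR u z * M1 u (pd 0 φ) (pd 1 φ) z with hG1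
  have sG0 : SmOn U G0 := hR.mul (M0_sm hU hu' hf0 hf1)
  have sG1 : SmOn U G1 := hR.mul (M1_sm hU hu' hf0 hf1)
  set B0 : E2 → ℝ := fun z =>
    Real.exp (u z) * (M0 u (bb u 0) (bb u 1) z * (RR u z * RR u z ^ 2)) with hB0
  set B1 : E2 → ℝ := fun z =>
    Real.exp (u z) * (M1 u (bb u 0) (bb u 1) z * (RR u z * RR u z ^ 2)) with hB1
  have sB0 : SmOn U B0 := hE.mul ((M0_sm hU hu' hb0 hb1).mul (hR.mul hR.sq))
  have sB1 : SmOn U B1 := hE.mul ((M1_sm hU hu' hb0 hb1).mul (hR.mul hR.sq))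
  set V0 : E2 → ℝ := fun z => φ z * (Real.exp (u z) * G0 z) + φ z ^ 2 * B0 z with hV0
  set V1 : E2 → ℝ := fun z => φ z * (Real.exp (u z) * G1 z) + φ z ^ 2 * B1 z with hV1
  have sV0 : SmOn U V0 := (hφ'.mul (hE.mul sG0)).add (hφ'.sq.mul sB0)
  have sV1 : SmOn U V1 := (hφ'.mul (hE.mul sG1)).add (hφ'.sq.mul sB1)
  have suV0 : Function.support V0 ⊆ K := by
    refine subset_trans ?_ hsupp
    intro z hz h0
    apply hz
    simp [hV0, h0]
  have suV1 : Function.support V1 ⊆ K := by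
    refine subset_trans ?_ hsupp
    intro z hz h0
    apply hz
    simp [hV1, h0]
  obtain ⟨i0, z0⟩ := integral_pd_zero hU sV0 hK hKU suV0 0
  obtain ⟨i1, z1⟩ := integral_pd_zero hU sV1 hK hKU suV1 1
  have main : ∀ y ∈ U, φ y * Lop (graphMap u) φ y
        * Real.exp (graphMap u y 2) * areaEl (graphMap u) y ≤ pd 0 V0 y + pd 1 V1 y := by
    intro y hy
    have hEp : ∀ i, HasPd i (fun z => Real.exp (u z)) _ y := fun i =>
      HasPd.comp (Real.hasDerivAt_exp (u y)) (hu'.hasPd hU i hy)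
    have hφp := fun i => hφ'.hasPd hU i hy
    have c0 := (((hφp 0).mul ((hEp 0).mul (sG0.hasPd hU 0 hy))).add
      ((hφp 0).sq.mul (sB0.hasPd hU 0 hy))).2
    have c1 := (((hφp 1).mul ((hEp 1).mul (sG1.hasPd hU 1 hy))).add
      ((hφp 1).sq.mul (sB1.hasPd hU 1 hy))).2
    have hdB := divB hU hu' hy htrans
    have hl0 : pd 0 (fun z => areaEl (graphMap u) z *
        ∑ j, fffInv (graphMap u) z 0 j * pd j φ z) y = pd 0 G0 y := by
      refine ((sG0.hasPd hU 0 hy).congr ?_ rfl).2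
      filter_upwards [hU.mem_nhds hy] with z hz
      rw [areaEl_graph hU hu' hz, fffInv_graph hU hu' hz, sqrt_DD, DD_inv]
      simp [hG0, M0]
      linear_combination (RR u z * ((1 + pd 1 u z ^ 2) * pd 0 φ z
        - (pd 0 u z * pd 1 u z) * pd 1 φ z)) * RR_sq u z
    have hl1 : pd 1 (fun z => areaEl (graphMap u) z *
        ∑ j, fffInv (graphMap u) z 1 j * pd j φ z) y = pd 1 G1 y := by
      refine ((sG1.hasPd hU 1 hy).congr ?_ rfl).2
      filter_upwards [hU.mem_nhds hy] with z hz
      rw [areaEl_graph hU hu' hz, fffInv_graph hU hu' hz, sqrt_DD, DD_inv]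
      simp [hG1, M1]
      linear_combination (RR u z * ((1 + pd 0 u z ^ 2) * pd 1 φ z
        - (pd 0 u z * pd 1 u z) * pd 0 φ z)) * RR_sq u z
    have hx : graphMap u y 2 = u y := rfl
    have hRD := RR_sq u y
    have hRp := RR_pos u y
    have hiW : (Real.sqrt (DD u y))⁻¹ = RR u y := rfl
    have hEpos := Real.exp_pos (u y)
    rw [hx, Lop, surfLap, Fin.sum_univ_two, hl0, hl1, grad_graph hU hu' hy,
      areaEl_graph hU hu' hy, hiW, sqrt_DD, DD_inv]
    have key : pd 0 V0 y + pd 1 V1 y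
      - φ y * (RR u y * (pd 0 G0 y + pd 1 G1 y) + sffNormSq (graphMap u) y * φ y +
        RR u y ^ 2 * (pd 0 u y * ((1+pd 1 u y^2) * pd 0 φ y - pd 0 u y * pd 1 u y * pd 1 φ y)
         + pd 1 u y * (-pd 0 u y * pd 1 u y * pd 0 φ y + (1+pd 0 u y^2) * pd 1 φ y)))
        * Real.exp (u y) * (DD u y * RR u y)
      = Real.exp (u y) * RR u y * ((pd 0 φ y + φ y * bb u 0 y * RR u y ^ 2) ^ 2
        + (pd 1 φ y + φ y * bb u 1 y * RR u y ^ 2) ^ 2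
        + (pd 1 u y * (pd 0 φ y + φ y * bb u 0 y * RR u y ^ 2)
          - pd 0 u y * (pd 1 φ y + φ y * bb u 1 y * RR u y ^ 2)) ^ 2) := by
      change pd 0 V0 y = _ at c0
      change pd 1 V1 y = _ at c1
      change pd 0 B0 y + pd 1 B1 y = _ at hdB
      rw [c0, c1]
      have eB0 : B0 y = Real.exp (u y) * (M0 u (bb u 0) (bb u 1) y * (RR u y * RR u y ^ 2)) := rfl
      have eB1 : B1 y = Real.exp (u y) * (M1 u (bb u 0) (bb u 1) y * (RR u y * RR u y ^ 2)) := rfl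
      have eG0 : G0 y = RR u y * M0 u (pd 0 φ) (pd 1 φ) y := rfl
      have eG1 : G1 y = RR u y * M1 u (pd 0 φ) (pd 1 φ) y := rfl
      rw [eB0, eB1, eG0, eG1]
      clear_value B0 B1 G0 G1 V0 V1
      simp only [M0, M1] at hdB ⊢
      linear_combination φ y ^ 2 * hdB - (φ y * Real.exp (u y) * (pd 0 G0 y + pd 1 G1 y) +
        φ y * Real.exp (u y) * RR u y *
        (pd 0 u y * ((1+pd 1 u y^2) * pd 0 φ y - pd 0 u y * pd 1 u y * pd 1 φ y)
         + pd 1 u y * (-pd 0 u y * pd 1 u y * pd 0 φ y + (1+pd 0 u y^2) * pd 1 φ y))) * hRD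
    have hnn : 0 ≤ Real.exp (u y) * RR u y * ((pd 0 φ y + φ y * bb u 0 y * RR u y ^ 2) ^ 2
        + (pd 1 φ y + φ y * bb u 1 y * RR u y ^ 2) ^ 2
        + (pd 1 u y * (pd 0 φ y + φ y * bb u 0 y * RR u y ^ 2)
          - pd 0 u y * (pd 1 φ y + φ y * bb u 1 y * RR u y ^ 2)) ^ 2) := by positivity
    rw [← key] at hnn
    linarith
  by_cases hI : IntegrableOn (fun y => φ y * Lop (graphMap u) φ y
        * Real.exp (graphMap u y 2) * areaEl (graphMap u) y) U
  · calc _ ≤ ∫ y in U, (pd 0 V0 y + pd 1 V1 y) :=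
          setIntegral_mono_on hI (i0.add i1) hU.measurableSet main
      _ = 0 := by rw [integral_add i0 i1, z0, z1, add_zero]
  · exact (integral_undef hI).le

end
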